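/- Let β ∈ Φ⁺ and write β = Σ_{α∈Δ₀} c_α α, where (c_α)_{α∈Δ} are the (nonnegative integer) coefficients of β with respect to Δ and c_{α₀} := 0. Then for every t ∈ ℤ: ω^t(β) ∈ Φ⁺ if and only if c_{ω^{−t}(α₀)} = 0. -/

import Mathlib

open scoped RealInnerProductSpace

namespace Folding

variable {E : Type*} [NormedAddCommGroup E] [InnerProductSpace ℝ E]

/-- The coroot `α^∨ = 2α/(α,α)` of a nonzero vector `α`. -/
noncomputable def coroot (α : E) : E := (2 / ⟪α, α⟫) • α

/-- The reflection `s_α(x) = x - (α^∨, x) α`. -/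
noncomputable def reflVec (α x : E) : E := x - ⟪coroot α, x⟫ • α

/-- `Φ` is a (finite, not necessarily reduced) root system in `E`. -/
def IsRootSystem (Φ : Set E) : Prop :=
  Φ.Finite ∧ (0 : E) ∉ Φ ∧ Submodule.span ℝ Φ = ⊤ ∧
    (∀ α ∈ Φ, ∀ β ∈ Φ, reflVec α β ∈ Φ) ∧
    ∀ α ∈ Φ, ∀ β ∈ Φ, ∃ n : ℤ, ⟪coroot α, β⟫ = (n : ℝ)

/-- `Φ` is reduced: no root is half of another root. -/
def IsReducedRS (Φ : Set E) : Prop := ∀ α ∈ Φ, (2⁻¹ : ℝ) • α ∉ Φ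

/-- `Φ` is irreducible: nonempty and not a disjoint union of two nonempty
mutually orthogonal subsets. -/
def IsIrreducibleRS (Φ : Set E) : Prop :=
  Φ.Nonempty ∧
    ¬∃ Φ₁ Φ₂ : Set E, Φ₁.Nonempty ∧ Φ₂.Nonempty ∧ Φ₁ ∪ Φ₂ = Φ ∧ Disjoint Φ₁ Φ₂ ∧
      ∀ u ∈ Φ₁, ∀ v ∈ Φ₂, ⟪u, v⟫ = 0

/-- `Δ` is a basis (a set of simple roots) of the root system `Φ`:
it is a vector space basis of `E`, and every root is a linear combination of `Δ`
whose coefficients are all nonnegative integers or all nonpositive integers. -/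
def IsBaseRS (Φ : Set E) (Δ : Finset E) : Prop :=
  ↑Δ ⊆ Φ ∧ LinearIndependent ℝ (fun α : {x : E // x ∈ Δ} => (α : E)) ∧
    Submodule.span ℝ (Δ : Set E) = ⊤ ∧
    ∀ β ∈ Φ, ∃ c : E → ℤ, ((∀ α, 0 ≤ c α) ∨ (∀ α, c α ≤ 0)) ∧
      β = ∑ α ∈ Δ, (c α : ℝ) • α

/-- `ω` belongs to the Weyl group of `Φ`: it is a product of reflections in roots. -/
def InWeylGroup (Φ : Set E) (ω : E ≃ₗᵢ[ℝ] E) : Prop :=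
  ∃ l : List E, (∀ α ∈ l, α ∈ Φ) ∧ ∀ x : E, ω x = l.foldr reflVec x

/-- The average `x^ω = (1/o(ω)) Σ_{t=1}^{o(ω)} ω^t(x)`, where `o(ω)` is the order of `ω`. -/
noncomputable def avg (ω : E ≃ₗᵢ[ℝ] E) (x : E) : E :=
  (orderOf ω : ℝ)⁻¹ • ∑ t ∈ Finset.range (orderOf ω), (ω ^ (t + 1)) x

/-- The fixed-point set `E^ω`. -/
def fixedSet (ω : E ≃ₗᵢ[ℝ] E) : Set E := {x | ω x = x}

/-- The fixed-point subspace `E^ω`. -/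
def fixedSubmodule (ω : E ≃ₗᵢ[ℝ] E) : Submodule ℝ E :=
  LinearMap.ker ((ω.toLinearEquiv : E →ₗ[ℝ] E) - LinearMap.id)

/-- The folded root system `Φ_re^ω = {β^ω : β ∈ Φ, β^ω ≠ 0}`. -/
noncomputable def foldedRoots (Φ : Set E) (ω : E ≃ₗᵢ[ℝ] E) : Set E :=
  {v | v ≠ 0 ∧ ∃ β ∈ Φ, avg ω β = v}

/-- The `⟨ω⟩`-orbit `O(β) = {ω^t(β) : t ∈ ℤ}`. -/
def orbitOf (ω : E ≃ₗᵢ[ℝ] E) (β : E) : Set E := {γ | ∃ t : ℤ, (ω ^ t) β = γ}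

/-- `N(β) = {γ ∈ O(β) : γ ≠ ±β, (β,γ) ≠ 0}`. -/
def nbrOf (ω : E ≃ₗᵢ[ℝ] E) (β : E) : Set E :=
  {γ | γ ∈ orbitOf ω β ∧ γ ≠ β ∧ γ ≠ -β ∧ ⟪β, γ⟫ ≠ 0}


/-- `Δ^ω`: the averages of the simple roots whose `⟨ω⟩`-orbit avoids `α₀ = -htilde`. -/
noncomputable def simpleAvg (Δ : Finset E) (htilde : E) (ω : E ≃ₗᵢ[ℝ] E) : Set E :=
  {v | ∃ α ∈ (Δ : Set E), -htilde ∉ orbitOf ω α ∧ avg ω α = v}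

/-- `π̄_S = (Σ_{α ∈ S} ϖ_α^∨)^ω` for a subset `S` of `Δ₀`. -/
noncomputable def pibar (ω : E ≃ₗᵢ[ℝ] E) (ϖ : E → E) (S : Set E) : E :=
  avg ω (∑ᶠ γ ∈ S, ϖ γ)

end Folding


open scoped Pointwise

namespace Folding

variable {E : Type*} [NormedAddCommGroup E] [InnerProductSpace ℝ E]

lemma reflVec_self {α : E} (hα : α ≠ 0) : reflVec α α = -α := by
  have h : ⟪α, α⟫ ≠ 0 := inner_self_ne_zero.mpr hα
  rw [reflVec, coroot, real_inner_smul_left, div_mul_cancel₀ _ h]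
  module

lemma IsRootSystem.neg_mem {Φ : Set E} (hΦ : IsRootSystem Φ) {α : E} (hα : α ∈ Φ) :
    -α ∈ Φ := by
  have h0 : α ≠ 0 := fun h => hΦ.2.1 (h ▸ hα)
  simpa [reflVec_self h0] using hΦ.2.2.2.1 α hα α hα

lemma InWeylGroup.image_eq {Φ : Set E} (hΦ : IsRootSystem Φ) {ω : E ≃ₗᵢ[ℝ] E}
    (hω : InWeylGroup Φ ω) : ω '' Φ = Φ := by
  obtain ⟨l, hl, hlω⟩ := hω
  have hfold : ∀ l : List E, (∀ α ∈ l, α ∈ Φ) → ∀ x ∈ Φ, l.foldr reflVec x ∈ Φ := by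
    intro l
    induction l with
    | nil => simp
    | cons a l ih =>
      intro hl x hx
      exact hΦ.2.2.2.1 a (hl a (by simp)) _ (ih (fun α hα => hl α (by simp [hα])) x hx)
  refine Set.eq_of_subset_of_ncard_le ?_ ?_ hΦ.1
  · rintro _ ⟨x, hx, rfl⟩
    rw [hlω]
    exact hfold l hl x hx
  · exact (Set.ncard_image_of_injective Φ ω.injective).ge

lemma zpow_image_eq {ω : E ≃ₗᵢ[ℝ] E} {S : Set E} (h : ω '' S = S) (t : ℤ) :
    (ω ^ t : E ≃ₗᵢ[ℝ] E) '' S = S := by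
  let _ : MulAction (E ≃ₗᵢ[ℝ] E) E :=
    { smul := fun g x => g x, one_smul := fun _ => rfl, mul_smul := fun _ _ _ => rfl }
  have hsmul (g : E ≃ₗᵢ[ℝ] E) : g • S = g '' S := rfl
  rw [← hsmul] at h ⊢
  exact zpow_mem (K := MulAction.stabilizer (E ≃ₗᵢ[ℝ] E) S) h t

/-- The coordinate functionals of a base, evaluated on linear combinations of the base. -/
lemma IsBaseRS.exists_coord {Φ : Set E} {Δ : Finset E} (hΔ : IsBaseRS Φ Δ) :
    ∃ f : E → E →ₗ[ℝ] ℝ, (∀ α ∈ Δ, f α α = 1) ∧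
      (∀ α ∈ Δ, ∀ γ ∈ Δ, γ ≠ α → f α γ = 0) ∧
      ∀ α ∈ Δ, ∀ c : E → ℝ, f α (∑ γ ∈ Δ, c γ • γ) = c α := by
  classical
  let b := Module.Basis.mk hΔ.2.1 (by simpa using hΔ.2.2.1.ge)
  have hb (α γ : E) (hα : α ∈ Δ) (hγ : γ ∈ Δ) :
      b.coord ⟨α, hα⟩ γ = if γ = α then 1 else 0 := by
    have h : b ⟨γ, hγ⟩ = γ := by simp [b]
    conv_lhs => rw [← h]
    simp [Finsupp.single_apply]
  refine ⟨fun α => if hα : α ∈ Δ then b.coord ⟨α, hα⟩ else 0, ?_, ?_, ?_⟩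
  · intro α hα
    simp only [hα, dite_true]
    rw [hb α α hα hα, if_pos rfl]
  · intro α hα γ hγ hne
    simp only [hα, dite_true]
    rw [hb α γ hα hγ, if_neg hne]
  · intro α hα c
    simp only [hα, dite_true, map_sum, map_smul, smul_eq_mul]
    rw [Finset.sum_congr rfl fun γ hγ => by rw [hb α γ hα hγ]]
    simp [hα]

/-- A root of maximal height has nonnegative coefficients. -/
lemma IsBaseRS.coeff_highest_nonneg {Φ : Set E} {Δ : Finset E} (hΦ : IsRootSystem Φ)
    (hΔ : IsBaseRS Φ Δ) {coeff : E → E → ℝ} {htilde : E}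
    (hcoeff : ∀ β ∈ Φ, β = ∑ α ∈ Δ, coeff β α • α) (hht : htilde ∈ Φ)
    (hhighest : ∀ β ∈ Φ, β ≠ htilde → ∑ α ∈ Δ, coeff β α < ∑ α ∈ Δ, coeff htilde α) :
    ∀ α ∈ Δ, 0 ≤ coeff htilde α := by
  obtain ⟨f, -, -, hf⟩ := hΔ.exists_coord
  have hfc : ∀ β ∈ Φ, ∀ α ∈ Δ, f α β = coeff β α := fun β hβ α hα => by
    conv_lhs => rw [hcoeff β hβ]
    exact hf α hα _
  have hne : -htilde ≠ htilde := by
    intro h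
    have h0 : IsAddTorsionFree E := .of_isTorsionFree ℝ E
    exact hΦ.2.1 (self_eq_neg.mp h.symm ▸ hht)
  have hlt := hhighest _ (hΦ.neg_mem hht) hne
  have hneg : ∑ α ∈ Δ, coeff (-htilde) α = -∑ α ∈ Δ, coeff htilde α := by
    rw [← Finset.sum_neg_distrib]
    refine Finset.sum_congr rfl fun α hα => ?_
    rw [← hfc _ (hΦ.neg_mem hht) α hα, ← hfc _ hht α hα, map_neg]
  obtain ⟨c, hc, hsum⟩ := hΔ.2.2.2 htilde hht
  have hcc : ∀ α ∈ Δ, coeff htilde α = c α := fun α hα => by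
    rw [← hfc _ hht α hα]
    conv_lhs => rw [hsum]
    exact hf α hα fun γ => (c γ : ℝ)
  rcases hc with hc | hc
  · intro α hα
    rw [hcc α hα]
    exact_mod_cast hc α
  · have : ∑ α ∈ Δ, coeff htilde α ≤ 0 := Finset.sum_nonpos fun α hα => by
      rw [hcc α hα]
      exact_mod_cast hc α
    linarith

end Folding

open Folding

theorem positivity_of_orbit_image
    {E : Type*} [NormedAddCommGroup E] [InnerProductSpace ℝ E] [FiniteDimensional ℝ E]
    (Φ : Set E) (Δ : Finset E) (coeff : E → E → ℝ) (htilde : E) (ω : E ≃ₗᵢ[ℝ] E)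
    (hΦrs : IsRootSystem Φ) (hΦred : IsReducedRS Φ) (hΦirr : IsIrreducibleRS Φ)
    (hΔ : IsBaseRS Φ Δ)
    (hcoeff : ∀ β ∈ Φ, β = ∑ α ∈ Δ, coeff β α • α)
    (hht : htilde ∈ Φ)
    (hhighest : ∀ β ∈ Φ, β ≠ htilde → ∑ α ∈ Δ, coeff β α < ∑ α ∈ Δ, coeff htilde α)
    (hωW : InWeylGroup Φ ω)
    (hωΔ₀ : ⇑ω '' (↑Δ ∪ {-htilde}) = ↑Δ ∪ {-htilde})
    (β : E) (hβ : β ∈ Φ) (hβpos : ∀ α ∈ Δ, 0 ≤ coeff β α) (t : ℤ) :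
    ((ω ^ t) β ∈ Φ ∧ ∀ α ∈ Δ, 0 ≤ coeff ((ω ^ t) β) α) ↔
      ((ω ^ (-t)) (-htilde) = -htilde ∨ coeff β ((ω ^ (-t)) (-htilde)) = 0) := by
  obtain ⟨f, hf1, hf0, hf⟩ := hΔ.exists_coord
  have hfc : ∀ β ∈ Φ, ∀ α ∈ Δ, f α β = coeff β α := fun β hβ α hα => by
    conv_lhs => rw [hcoeff β hβ]
    exact hf α hα _
  have hm := hΔ.coeff_highest_nonneg hΦrs hcoeff hht hhighest
  have hα₀ : -htilde ∉ Δ := fun h => by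
    have h1 := hf1 _ h
    rw [map_neg, hfc _ hht _ h] at h1
    linarith [hm _ h]
  have hΦ : ∀ x ∈ Φ, (ω ^ t) x ∈ Φ := fun x hx => by
    rw [← zpow_image_eq (hωW.image_eq hΦrs) t]
    exact Set.mem_image_of_mem _ hx
  have hΔ₀ : ∀ s : ℤ, ∀ x, x ∈ Δ ∨ x = -htilde → (ω ^ s) x ∈ Δ ∨ (ω ^ s) x = -htilde := by
    intro s x hx
    have h : (ω ^ s) x ∈ (ω ^ s : E ≃ₗᵢ[ℝ] E) '' (↑Δ ∪ {-htilde}) :=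
      Set.mem_image_of_mem _ (by simpa using hx.symm)
    rw [zpow_image_eq hωΔ₀ s] at h
    simpa [or_comm] using h
  have hinv : ∀ x, (ω ^ t) ((ω ^ (-t)) x) = x := fun x => by
    rw [zpow_neg]
    exact (ω ^ t).apply_symm_apply x
  have hinj := (ω ^ t).injective
  set σ := ω ^ t
  set α' := (ω ^ (-t)) (-htilde) with hα'
  have hσα' : σ α' = -htilde := hinv _
  have hfσ : ∀ x ∈ Φ, ∀ γ, f γ (σ x) = ∑ α ∈ Δ, coeff x α * f γ (σ α) := fun x hx γ => by
    conv_lhs => rw [hcoeff x hx]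
    simp [map_sum]
  constructor
  · rintro ⟨-, hpos⟩
    by_contra! hcon
    obtain ⟨hne, hc⟩ := hcon
    have hα'Δ : α' ∈ Δ := (hΔ₀ (-t) _ (Or.inr rfl)).resolve_right hne
    have hδΔ : σ (-htilde) ∈ Δ :=
      (hΔ₀ t _ (Or.inr rfl)).resolve_right fun h => hne (hinj (hσα'.trans h.symm))
    set δ := σ (-htilde) with hδ
    have key : ∀ x ∈ Φ, f δ (σ x) = -(coeff x α' * coeff htilde δ) := fun x hx => by
      rw [hfσ x hx, Finset.sum_eq_single_of_mem α' hα'Δ, hσα', map_neg, hfc _ hht δ hδΔ,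
        mul_neg]
      intro α hα hαα'
      have hσα : σ α ∈ Δ := (hΔ₀ t α (Or.inl hα)).resolve_right fun h =>
        hαα' (hinj (h.trans hσα'.symm))
      rw [hf0 δ hδΔ _ hσα fun h => hα₀ (hinj h ▸ hα), mul_zero]
    have hδ0 : coeff htilde δ ≠ 0 := fun h => by
      have h1 := key _ (hΦrs.neg_mem hht)
      rw [← hδ, hf1 δ hδΔ, h] at h1
      simp at h1
    have h1 := hpos δ hδΔ
    rw [← hfc _ (hΦ β hβ) δ hδΔ, key β hβ] at h1
    have h2 := mul_pos ((hβpos _ hα'Δ).lt_of_ne' hc) ((hm δ hδΔ).lt_of_ne' hδ0)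
    linarith
  · intro h
    refine ⟨hΦ β hβ, fun γ hγ => ?_⟩
    rw [← hfc _ (hΦ β hβ) γ hγ, hfσ β hβ]
    refine Finset.sum_nonneg fun α hα => ?_
    rcases hΔ₀ t α (Or.inl hα) with hσα | hσα
    · refine mul_nonneg (hβpos α hα) ?_
      rcases eq_or_ne (σ α) γ with he | he
      · rw [he, hf1 γ hγ]
        exact zero_le_one
      · rw [hf0 γ hγ _ hσα he]
    · have hαα' : α = α' := hinj (hσα.trans hσα'.symm)
      rcases h with h | h
      · exact absurd (h ▸ hαα' ▸ hα) hα₀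
      · rw [hαα', h, zero_mul]
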